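/- Fidelity induction bound: let ξ ∈ [0,1] and let F₀, F₁, …, F_z be nonnegative reals in [0,1] satisfying F₀ = 1 and F_j ≥ √(1−ξ)·F_{j−1} − √ξ for each j ≥ 1. Then F_z ≥ (1 − ξ^{1/4})^{z/2} − 2ξ^{1/4} for all z ≥ 0 (assuming z steps, with at most z nontrivial updates). -/

import Mathlib

/-- `√(1 - t) ≤ 1 - t / 2`, Bernoulli's inequality with exponent `1 / 2`. -/
theorem sqrt_one_sub_le {t : ℝ} (ht : t ≤ 1) : √(1 - t) ≤ 1 - t / 2 :=
  Real.sqrt_le_iff.mpr ⟨by linarith, by nlinarith [sq_nonneg t]⟩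

/-- A nonnegative sequence starting at `1` that loses at most a factor `√(1 - t ^ 4)` and a term
`t ^ 2` at each step stays above `√(1 - t) ^ n - 2 * t`. -/
theorem sqrt_pow_sub_le_of_step {t : ℝ} (ht0 : 0 ≤ t) (ht1 : t ≤ 1) {F : ℕ → ℝ}
    (hF : ∀ n, 0 ≤ F n) (h0 : F 0 = 1)
    (hstep : ∀ n, √(1 - t ^ 4) * F n - t ^ 2 ≤ F (n + 1)) (n : ℕ) :
    √(1 - t) ^ n - 2 * t ≤ F n := by
  induction n with
  | zero => simp [h0, ht0]
  | succ n ih =>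
    have hsqrt : √(1 - t) ≤ √(1 - t ^ 4) :=
      Real.sqrt_le_sqrt (by linarith [pow_le_of_le_one ht0 ht1 (n := 4) (by norm_num)])
    calc √(1 - t) ^ (n + 1) - 2 * t
        ≤ √(1 - t) * (√(1 - t) ^ n - 2 * t) - t ^ 2 := by
          rw [pow_succ]
          linarith [mul_le_mul_of_nonneg_left (sqrt_one_sub_le ht1) ht0]
      _ ≤ √(1 - t) * F n - t ^ 2 := by gcongr
      _ ≤ √(1 - t ^ 4) * F n - t ^ 2 := by gcongr; exact hF n
      _ ≤ F (n + 1) := hstep n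

/-- Fidelity induction bound: if `F₀ = 1`, `F_j ∈ [0,1]`, and
`F_j ≥ √(1−ξ) F_{j−1} − √ξ` for all `j ≥ 1`, then
`F_z ≥ (1 − ξ^{1/4})^{z/2} − 2 ξ^{1/4}` for all `z ≥ 0`. -/
theorem fidelity_induction (ξ : ℝ) (hξ0 : 0 ≤ ξ) (hξ1 : ξ ≤ 1)
    (F : ℕ → ℝ) (hF : ∀ j, 0 ≤ F j ∧ F j ≤ 1) (h0 : F 0 = 1)
    (hstep : ∀ j, 1 ≤ j → F j ≥ Real.sqrt (1 - ξ) * F (j - 1) - Real.sqrt ξ) :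
    ∀ z : ℕ, F z ≥ (1 - ξ ^ ((1 : ℝ) / 4)) ^ ((z : ℝ) / 2) - 2 * ξ ^ ((1 : ℝ) / 4) := by
  intro z
  set t := ξ ^ ((1 : ℝ) / 4) with ht
  have ht0 : 0 ≤ t := Real.rpow_nonneg hξ0 _
  have ht1 : t ≤ 1 := Real.rpow_le_one hξ0 hξ1 (by norm_num)
  have ht4 : ξ = t ^ 4 := by
    rw [ht, ← Real.rpow_mul_natCast hξ0]
    norm_num
  have hsqrt : √ξ = t ^ 2 := by
    rw [ht4, show t ^ 4 = (t ^ 2) ^ 2 by ring, Real.sqrt_sq (sq_nonneg t)]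
  have hpow : (1 - t) ^ ((z : ℝ) / 2) = √(1 - t) ^ z := by
    rw [Real.sqrt_eq_rpow, ← Real.rpow_mul_natCast (by linarith)]
    congr 1
    ring
  rw [hpow]
  refine sqrt_pow_sub_le_of_step ht0 ht1 (fun n => (hF n).1) h0 (fun n => ?_) z
  rw [← ht4, ← hsqrt]
  exact hstep (n + 1) n.succ_pos
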